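/- arXiv:solv-int/9805005 — 2 statements merged into one kernel-verified Lean document; each statement's English description precedes it below -/
import Mathlib

section
/- Let β_ij satisfy the Darboux equations on a nonempty open connected U ⊆ ℝ^N, let ξ_i : U → ℝ^M be an X-solution and ξ*_i an H-solution for β, with potential Ω := Ω(ξ,ξ*) invertible everywhere on U, and set β̂_ij := β_ij − ξ*_j Ω⁻¹ ξ_i. Let ζ*_i be any further H-solution for β with values in row vectors of length M', and Ω(ξ,ζ*) a potential for (ξ,ζ*). Then the transformed family ζ̂*_i := ζ*_i − ξ*_i Ω⁻¹ Ω(ξ,ζ*) is an H-solution for β̂, i.e. ∂_i ζ̂*_j = β̂_ij ζ̂*_i for all i ≠ j. -/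
open Matrix Finset

/-- Partial derivative of a scalar function on `ℝ^N` in the `i`-th coordinate direction. -/
noncomputable def pd {N : ℕ} (i : Fin N) (f : (Fin N → ℝ) → ℝ) (u : Fin N → ℝ) : ℝ :=
  fderiv ℝ f u (Pi.single i 1)

theorem differentiableAt_matrix_det {E : Type*} [NormedAddCommGroup E] [NormedSpace ℝ E] {m : ℕ}
    {A : E → Matrix (Fin m) (Fin m) ℝ} {u : E}
    (hA : ∀ a b, DifferentiableAt ℝ (fun v => A v a b) u) :
    DifferentiableAt ℝ (fun v => (A v).det) u := by
  simp only [Matrix.det_apply]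
  fun_prop

theorem differentiableAt_matrix_inv {E : Type*} [NormedAddCommGroup E] [NormedSpace ℝ E] {m : ℕ}
    {A : E → Matrix (Fin m) (Fin m) ℝ} {u : E}
    (hA : ∀ a b, DifferentiableAt ℝ (fun v => A v a b) u) (hu : IsUnit (A u).det) (a b : Fin m) :
    DifferentiableAt ℝ (fun v => (A v)⁻¹ a b) u := by
  simp only [Matrix.inv_def, Ring.inverse_eq_inv', Matrix.smul_apply, smul_eq_mul,
    Matrix.adjugate_apply]
  refine ((differentiableAt_matrix_det hA).inv hu.ne_zero).mul (differentiableAt_matrix_det ?_)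
  intro c d
  by_cases h : c = b
  · subst h
    simp
  · simpa [Matrix.updateRow_ne h] using hA c d

theorem differentiableAt_vecMul {E : Type*} [NormedAddCommGroup E] [NormedSpace ℝ E] {m n : ℕ}
    {w : E → Fin m → ℝ} {A : E → Matrix (Fin m) (Fin n) ℝ} {u : E}
    (hw : ∀ a, DifferentiableAt ℝ (fun v => w v a) u)
    (hA : ∀ a b, DifferentiableAt ℝ (fun v => A v a b) u) (b : Fin n) :
    DifferentiableAt ℝ (fun v => (w v ᵥ* A v) b) u := by
  simp only [Matrix.vecMul, dotProduct]
  fun_prop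

/-- Product rule for the partial derivatives of a vector-matrix product. -/
theorem pd_vecMul {N m n : ℕ} (i : Fin N) {w : (Fin N → ℝ) → Fin m → ℝ}
    {A : (Fin N → ℝ) → Matrix (Fin m) (Fin n) ℝ} {u : Fin N → ℝ}
    (hw : ∀ a, DifferentiableAt ℝ (fun v => w v a) u)
    (hA : ∀ a b, DifferentiableAt ℝ (fun v => A v a b) u) (b : Fin n) :
    pd i (fun v => (w v ᵥ* A v) b) u
      = ((fun a => pd i (fun v => w v a) u) ᵥ* A u) b
        + w u ⬝ᵥ fun a => pd i (fun v => A v a b) u := by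
  simp only [Matrix.vecMul, dotProduct, pd]
  rw [fderiv_fun_sum fun a _ => (hw a).fun_mul (hA a b), ← Finset.sum_add_distrib,
    _root_.sum_apply]
  refine Finset.sum_congr rfl fun a _ => ?_
  rw [fderiv_fun_mul (hw a) (hA a b)]
  simp
  ring

/-- If `x_j`, `x_i` are rows with `∂_i x_j = c x_i` and `∂_i A` is the outer product of `y` and
`x_i`, then `∂_i (x_j A⁻¹) = (c - x_j A⁻¹ y) x_i A⁻¹`. -/
theorem pd_vecMul_inv {N m : ℕ} (i : Fin N) {x : (Fin N → ℝ) → Fin m → ℝ}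
    {A : (Fin N → ℝ) → Matrix (Fin m) (Fin m) ℝ} {u : Fin N → ℝ} {c : ℝ} {y z : Fin m → ℝ}
    (hx : ∀ a, DifferentiableAt ℝ (fun v => x v a) u)
    (hA : ∀ a b, DifferentiableAt ℝ (fun v => A v a b) u)
    (hdet : ∀ᶠ v in nhds u, IsUnit (A v).det)
    (hpx : ∀ b, pd i (fun v => x v b) u = c * z b)
    (hpA : ∀ a b, pd i (fun v => A v a b) u = y a * z b) :
    (fun a => pd i (fun v => (x v ᵥ* (A v)⁻¹) a) u)
      = (c - (x u ᵥ* (A u)⁻¹) ⬝ᵥ y) • (z ᵥ* (A u)⁻¹) := by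
  have hu := hdet.self_of_nhds
  have hw := differentiableAt_vecMul hx (differentiableAt_matrix_inv hA hu)
  have key : (fun a => pd i (fun v => (x v ᵥ* (A v)⁻¹) a) u) ᵥ* A u
      = (c - (x u ᵥ* (A u)⁻¹) ⬝ᵥ y) • z := by
    ext b
    have hprod := pd_vecMul i hw hA b
    have hcancel : (fun v => ((x v ᵥ* (A v)⁻¹) ᵥ* A v) b) =ᶠ[nhds u] fun v => x v b := by
      filter_upwards [hdet] with v hv
      rw [Matrix.vecMul_vecMul, Matrix.nonsing_inv_mul _ hv, Matrix.vecMul_one]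
    have hleft : pd i (fun v => ((x v ᵥ* (A v)⁻¹) ᵥ* A v) b) u = c * z b := by
      rw [← hpx b, pd, pd, hcancel.fderiv_eq]
    have hdot : ((x u ᵥ* (A u)⁻¹) ⬝ᵥ fun a => y a * z b) = ((x u ᵥ* (A u)⁻¹) ⬝ᵥ y) * z b := by
      simp only [dotProduct, Finset.sum_mul, mul_assoc]
    simp only [hpA] at hprod
    rw [hleft, hdot] at hprod
    simp only [Pi.smul_apply, smul_eq_mul]
    linarith
  rw [← Matrix.smul_vecMul, ← key, Matrix.vecMul_vecMul, Matrix.mul_nonsing_inv _ hu,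
    Matrix.vecMul_one]

/-- The transformed family `ζ̂*_i := ζ*_i − ξ*_i Ω⁻¹ Ω(ξ,ζ*)` is an H-solution for
the transformed rotation coefficients `β̂_ij := β_ij − ξ*_j Ω⁻¹ ξ_i`. -/
theorem stmt_6 {N M M' : ℕ} (hN : 2 ≤ N)
    (U : Set (Fin N → ℝ)) (hUopen : IsOpen U) (hUconn : IsConnected U)
    (β : Fin N → Fin N → (Fin N → ℝ) → ℝ)
    (hβsmooth : ∀ i j : Fin N, i ≠ j → ContDiffOn ℝ (⊤ : ℕ∞) (β i j) U)
    (hDarboux : ∀ i j k : Fin N, i ≠ j → j ≠ k → i ≠ k → ∀ u ∈ U,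
      pd k (β i j) u = β i k u * β k j u)
    (ξ : Fin N → (Fin N → ℝ) → Fin M → ℝ)
    (hξsmooth : ∀ (j : Fin N) (a : Fin M), ContDiffOn ℝ (⊤ : ℕ∞) (fun u => ξ j u a) U)
    (hξX : ∀ i j : Fin N, i ≠ j → ∀ u ∈ U, ∀ a : Fin M,
      pd i (fun v => ξ j v a) u = β j i u * ξ i u a)
    (ξs : Fin N → (Fin N → ℝ) → Fin M → ℝ)
    (hξssmooth : ∀ (j : Fin N) (b : Fin M), ContDiffOn ℝ (⊤ : ℕ∞) (fun u => ξs j u b) U)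
    (hξsH : ∀ i j : Fin N, i ≠ j → ∀ u ∈ U, ∀ b : Fin M,
      pd i (fun v => ξs j v b) u = β i j u * ξs i u b)
    (Ω : (Fin N → ℝ) → Matrix (Fin M) (Fin M) ℝ)
    (hΩsmooth : ∀ (a b : Fin M), ContDiffOn ℝ (⊤ : ℕ∞) (fun u => Ω u a b) U)
    (hΩ : ∀ i : Fin N, ∀ u ∈ U, ∀ (a b : Fin M),
      pd i (fun v => Ω v a b) u = ξ i u a * ξs i u b)
    (hΩinv : ∀ u ∈ U, IsUnit (Ω u).det)
    (ζs : Fin N → (Fin N → ℝ) → Fin M' → ℝ)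
    (hζssmooth : ∀ (j : Fin N) (b : Fin M'), ContDiffOn ℝ (⊤ : ℕ∞) (fun u => ζs j u b) U)
    (hζsH : ∀ i j : Fin N, i ≠ j → ∀ u ∈ U, ∀ b : Fin M',
      pd i (fun v => ζs j v b) u = β i j u * ζs i u b)
    (Ωξζ : (Fin N → ℝ) → Matrix (Fin M) (Fin M') ℝ)
    (hΩξζsmooth : ∀ (a : Fin M) (b : Fin M'), ContDiffOn ℝ (⊤ : ℕ∞) (fun u => Ωξζ u a b) U)
    (hΩξζ : ∀ i : Fin N, ∀ u ∈ U, ∀ (a : Fin M) (b : Fin M'),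
      pd i (fun v => Ωξζ v a b) u = ξ i u a * ζs i u b) :
    ∀ i j : Fin N, i ≠ j → ∀ u ∈ U, ∀ b : Fin M',
      pd i (fun v => ζs j v b - ((ξs j v ᵥ* (Ω v)⁻¹) ᵥ* Ωξζ v) b) u
        = (β i j u - (ξs j u ᵥ* (Ω u)⁻¹) ⬝ᵥ ξ i u)
          * (ζs i u b - ((ξs i u ᵥ* (Ω u)⁻¹) ᵥ* Ωξζ u) b) := by
  intro i j hij u hu b
  have hnhds : U ∈ nhds u := hUopen.mem_nhds hu
  have hdiff : ∀ {f : (Fin N → ℝ) → ℝ}, ContDiffOn ℝ (⊤ : ℕ∞) f U → DifferentiableAt ℝ f u :=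
    fun hf => (hf.contDiffAt hnhds).differentiableAt (by simp)
  have hξs := fun a => hdiff (hξssmooth j a)
  have hΩd := fun a b => hdiff (hΩsmooth a b)
  have hΩξζd := fun a b => hdiff (hΩξζsmooth a b)
  have hw := differentiableAt_vecMul hξs (differentiableAt_matrix_inv hΩd (hΩinv u hu))
  have hdw := pd_vecMul_inv i hξs hΩd (Filter.eventually_of_mem hnhds hΩinv)
    (hξsH i j hij u hu) (hΩ i u hu)
  have hprod := pd_vecMul i hw hΩξζd b
  have hdot : ((ξs j u ᵥ* (Ω u)⁻¹) ⬝ᵥ fun a => ξ i u a * ζs i u b)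
      = ((ξs j u ᵥ* (Ω u)⁻¹) ⬝ᵥ ξ i u) * ζs i u b := by
    simp only [dotProduct, Finset.sum_mul, mul_assoc]
  simp only [hΩξζ i u hu] at hprod
  rw [hdw, hdot, Matrix.smul_vecMul, Pi.smul_apply, smul_eq_mul] at hprod
  have hsub : pd i (fun v => ζs j v b - ((ξs j v ᵥ* (Ω v)⁻¹) ᵥ* Ωξζ v) b) u
      = pd i (fun v => ζs j v b) u - pd i (fun v => ((ξs j v ᵥ* (Ω v)⁻¹) ᵥ* Ωξζ v) b) u := by
    simp only [pd]
    rw [fderiv_fun_sub (hdiff (hζssmooth j b)) (differentiableAt_vecMul hw hΩξζd b)]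
    simp
  rw [hsub, hζsH i j hij u hu b, hprod]
  ring
end

section
/- Let β_ij satisfy the Darboux equations on a nonempty open connected U ⊆ ℝ^N. Let X_i : U → ℝ^D be an X-solution, H_i : U → ℝ an H-solution, and x : U → ℝ^D a smooth map with ∂_i x = H_i X_i for all i. Let ξ_i : U → ℝ^M be an X-solution and ξ*_i an H-solution (row vectors of length M), with potentials Ω := Ω(ξ,ξ*) (invertible on U), Ω(X,ξ*) (D×M) and Ω(ξ,H) (columns of length M, satisfying ∂_i Ω(ξ,H) = ξ_i H_i). Define X̂_i := X_i − Ω(X,ξ*) Ω⁻¹ ξ_i, Ĥ_i := H_i − ξ*_i Ω⁻¹ Ω(ξ,H), and x̂ := x − Ω(X,ξ*) Ω⁻¹ Ω(ξ,H). Then ∂_i x̂ = Ĥ_i X̂_i for all i = 1,…,N. -/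
open Matrix Finset

section PartialDerivatives

variable {N : ℕ} {i : Fin N} {u : Fin N → ℝ}

theorem pd_sub {f g : (Fin N → ℝ) → ℝ} (hf : DifferentiableAt ℝ f u)
    (hg : DifferentiableAt ℝ g u) :
    pd i (fun v => f v - g v) u = pd i f u - pd i g u := by
  simp [pd, fderiv_fun_sub hf hg]

theorem pd_mul {f g : (Fin N → ℝ) → ℝ} (hf : DifferentiableAt ℝ f u)
    (hg : DifferentiableAt ℝ g u) :
    pd i (fun v => f v * g v) u = pd i f u * g u + f u * pd i g u := by
  simp only [pd, fderiv_fun_mul hf hg, _root_.add_apply,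
    _root_.smul_apply, smul_eq_mul]
  ring

theorem pd_dotProduct {n : Type*} [Fintype n] {f g : (Fin N → ℝ) → n → ℝ}
    (hf : ∀ k, DifferentiableAt ℝ (fun v => f v k) u)
    (hg : ∀ k, DifferentiableAt ℝ (fun v => g v k) u) :
    pd i (fun v => f v ⬝ᵥ g v) u =
      (fun k => pd i (fun v => f v k) u) ⬝ᵥ g u + f u ⬝ᵥ fun k => pd i (fun v => g v k) u := by
  have hsum : pd i (fun v => ∑ k, f v k * g v k) u = ∑ k, pd i (fun v => f v k * g v k) u := by
    simp [pd, fderiv_fun_sum fun k _ => (hf k).fun_mul (hg k)]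
  simp only [dotProduct, hsum, pd_mul (hf _) (hg _), Finset.sum_add_distrib]

theorem differentiableAt_dotProduct {n : Type*} [Fintype n] {f g : (Fin N → ℝ) → n → ℝ}
    (hf : ∀ k, DifferentiableAt ℝ (fun v => f v k) u)
    (hg : ∀ k, DifferentiableAt ℝ (fun v => g v k) u) :
    DifferentiableAt ℝ (fun v => f v ⬝ᵥ g v) u :=
  DifferentiableAt.fun_sum fun k _ => (hf k).fun_mul (hg k)

section Inverse

variable {n : Type*} [Fintype n] [DecidableEq n] {B : (Fin N → ℝ) → Matrix n n ℝ}

theorem differentiableAt_matrix_det_s7 (hB : ∀ a b, DifferentiableAt ℝ (fun v => B v a b) u) :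
    DifferentiableAt ℝ (fun v => (B v).det) u := by
  simp only [Matrix.det_apply']
  exact DifferentiableAt.fun_sum fun σ _ =>
    (differentiableAt_const _).fun_mul
      (HasFDerivAt.finsetProd fun k _ => (hB (σ k) k).hasFDerivAt).differentiableAt

theorem differentiableAt_matrix_inv_apply
    (hB : ∀ a b, DifferentiableAt ℝ (fun v => B v a b) u) (hdet : IsUnit (B u).det) (a b : n) :
    DifferentiableAt ℝ (fun v => (B v)⁻¹ a b) u := by
  simp only [Matrix.inv_def, Ring.inverse_eq_inv', Matrix.smul_apply, smul_eq_mul,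
    Matrix.adjugate_apply]
  refine ((differentiableAt_matrix_det_s7 hB).fun_inv hdet.ne_zero).fun_mul
    (differentiableAt_matrix_det_s7 fun c d => ?_)
  by_cases h : c = b
  · simp [Matrix.updateRow_apply, h]
  · simpa [Matrix.updateRow_apply, h] using hB c d

theorem pd_matrix_inv_apply
    (hB : ∀ a b, DifferentiableAt ℝ (fun v => B v a b) u) (hdet : IsUnit (B u).det) (a b : n) :
    pd i (fun v => (B v)⁻¹ a b) u =
      -((B u)⁻¹ * Matrix.of (fun c d => pd i (fun v => B v c d) u) * (B u)⁻¹) a b := by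
  have hinv := differentiableAt_matrix_inv_apply hB hdet
  set B' : Matrix n n ℝ := Matrix.of fun c d => pd i (fun v => B v c d) u with hB'
  set C' : Matrix n n ℝ := Matrix.of fun c d => pd i (fun v => (B v)⁻¹ c d) u with hC'
  have hprod : B' * (B u)⁻¹ + B u * C' = 0 := by
    ext c d
    have hconst : (fun v => (fun k => B v c k) ⬝ᵥ fun k => (B v)⁻¹ k d) =ᶠ[nhds u]
        fun _ => (1 : Matrix n n ℝ) c d := by
      filter_upwards [(differentiableAt_matrix_det_s7 hB).continuousAt.eventually_ne hdet.ne_zero]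
        with v hv
      rw [← Matrix.mul_nonsing_inv (B v) hv.isUnit]
      rfl
    have hpd := pd_dotProduct (i := i) (f := fun v k => B v c k) (g := fun v k => (B v)⁻¹ k d)
      (fun k => hB c k) fun k => hinv k d
    rw [pd, hconst.fderiv_eq] at hpd
    simpa [Matrix.mul_apply, dotProduct, hB', hC'] using hpd.symm
  have hC : C' = -((B u)⁻¹ * B' * (B u)⁻¹) := by
    rw [Matrix.mul_assoc, eq_neg_of_add_eq_zero_left hprod, Matrix.mul_neg, neg_neg,
      Matrix.nonsing_inv_mul_cancel_left _ _ hdet]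
  exact congrFun (congrFun hC a) b

end Inverse

end PartialDerivatives

/-- The transformed point map `x̂ = x − Ω(X,ξ*) Ω⁻¹ Ω(ξ,H)` satisfies
`∂_i x̂ = Ĥ_i X̂_i` with the transformed tangent vectors and Lamé coefficients. -/
theorem stmt_7 {N M D : ℕ} (hN : 2 ≤ N)
    (U : Set (Fin N → ℝ)) (hUopen : IsOpen U) (hUconn : IsConnected U)
    (β : Fin N → Fin N → (Fin N → ℝ) → ℝ)
    (hβsmooth : ∀ i j : Fin N, i ≠ j → ContDiffOn ℝ (⊤ : ℕ∞) (β i j) U)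
    (hDarboux : ∀ i j k : Fin N, i ≠ j → j ≠ k → i ≠ k → ∀ u ∈ U,
      pd k (β i j) u = β i k u * β k j u)
    (X : Fin N → (Fin N → ℝ) → Fin D → ℝ)
    (hXsmooth : ∀ (j : Fin N) (a : Fin D), ContDiffOn ℝ (⊤ : ℕ∞) (fun u => X j u a) U)
    (hXX : ∀ i j : Fin N, i ≠ j → ∀ u ∈ U, ∀ a : Fin D,
      pd i (fun v => X j v a) u = β j i u * X i u a)
    (H : Fin N → (Fin N → ℝ) → ℝ)
    (hHsmooth : ∀ j : Fin N, ContDiffOn ℝ (⊤ : ℕ∞) (H j) U)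
    (hHH : ∀ i j : Fin N, i ≠ j → ∀ u ∈ U, pd i (H j) u = β i j u * H i u)
    (x : (Fin N → ℝ) → Fin D → ℝ)
    (hxsmooth : ∀ a : Fin D, ContDiffOn ℝ (⊤ : ℕ∞) (fun u => x u a) U)
    (hx : ∀ i : Fin N, ∀ u ∈ U, ∀ a : Fin D,
      pd i (fun v => x v a) u = H i u * X i u a)
    (ξ : Fin N → (Fin N → ℝ) → Fin M → ℝ)
    (hξsmooth : ∀ (j : Fin N) (a : Fin M), ContDiffOn ℝ (⊤ : ℕ∞) (fun u => ξ j u a) U)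
    (hξX : ∀ i j : Fin N, i ≠ j → ∀ u ∈ U, ∀ a : Fin M,
      pd i (fun v => ξ j v a) u = β j i u * ξ i u a)
    (ξs : Fin N → (Fin N → ℝ) → Fin M → ℝ)
    (hξssmooth : ∀ (j : Fin N) (b : Fin M), ContDiffOn ℝ (⊤ : ℕ∞) (fun u => ξs j u b) U)
    (hξsH : ∀ i j : Fin N, i ≠ j → ∀ u ∈ U, ∀ b : Fin M,
      pd i (fun v => ξs j v b) u = β i j u * ξs i u b)
    (Ω : (Fin N → ℝ) → Matrix (Fin M) (Fin M) ℝ)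
    (hΩsmooth : ∀ (a b : Fin M), ContDiffOn ℝ (⊤ : ℕ∞) (fun u => Ω u a b) U)
    (hΩ : ∀ i : Fin N, ∀ u ∈ U, ∀ (a b : Fin M),
      pd i (fun v => Ω v a b) u = ξ i u a * ξs i u b)
    (hΩinv : ∀ u ∈ U, IsUnit (Ω u).det)
    (ΩXξ : (Fin N → ℝ) → Matrix (Fin D) (Fin M) ℝ)
    (hΩXξsmooth : ∀ (a : Fin D) (b : Fin M), ContDiffOn ℝ (⊤ : ℕ∞) (fun u => ΩXξ u a b) U)
    (hΩXξ : ∀ i : Fin N, ∀ u ∈ U, ∀ (a : Fin D) (b : Fin M),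
      pd i (fun v => ΩXξ v a b) u = X i u a * ξs i u b)
    (ΩξH : (Fin N → ℝ) → Fin M → ℝ)
    (hΩξHsmooth : ∀ a : Fin M, ContDiffOn ℝ (⊤ : ℕ∞) (fun u => ΩξH u a) U)
    (hΩξH : ∀ i : Fin N, ∀ u ∈ U, ∀ a : Fin M,
      pd i (fun v => ΩξH v a) u = ξ i u a * H i u) :
    ∀ i : Fin N, ∀ u ∈ U, ∀ a : Fin D,
      pd i (fun v => x v a - ((ΩXξ v * (Ω v)⁻¹) *ᵥ ΩξH v) a) u
        = (H i u - (ξs i u ᵥ* (Ω u)⁻¹) ⬝ᵥ ΩξH u)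
          * (X i u a - ((ΩXξ u * (Ω u)⁻¹) *ᵥ ξ i u) a) := by
  intro i u hu a
  have diff {f : (Fin N → ℝ) → ℝ} (hf : ContDiffOn ℝ (⊤ : ℕ∞) f U) : DifferentiableAt ℝ f u :=
    (hf.contDiffAt (hUopen.mem_nhds hu)).differentiableAt (by simp)
  have hΩd a b := diff (hΩsmooth a b)
  have hAd b := diff (hΩXξsmooth a b)
  have hhd b := diff (hΩξHsmooth b)
  have hdet := hΩinv u hu
  have hInvd := differentiableAt_matrix_inv_apply hΩd hdet
  have hΩ' : Matrix.of (fun c d => pd i (fun v => Ω v c d) u) =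
      Matrix.vecMulVec (ξ i u) (ξs i u) := by
    ext c d
    exact hΩ i u hu c d
  have hPd b : DifferentiableAt ℝ (fun v => (ΩXξ v * (Ω v)⁻¹) a b) u :=
    differentiableAt_dotProduct hAd fun k => hInvd k b
  have hP b : pd i (fun v => (ΩXξ v * (Ω v)⁻¹) a b) u =
      (X i u a - ((ΩXξ u * (Ω u)⁻¹) *ᵥ ξ i u) a) * (ξs i u ᵥ* (Ω u)⁻¹) b := by
    refine (pd_dotProduct hAd fun k => hInvd k b).trans ?_
    simp only [pd_matrix_inv_apply hΩd hdet, hΩ', hΩXξ i u hu, Matrix.mul_vecMulVec,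
      Matrix.vecMulVec_mul, Matrix.vecMulVec_apply]
    rw [sub_mul, sub_eq_add_neg, ← Matrix.mulVec_mulVec]
    congr 1
    · simp only [Matrix.vecMul, dotProduct, Finset.mul_sum, mul_assoc]
    · generalize (Ω u)⁻¹ *ᵥ ξ i u = q
      simp only [Matrix.mulVec, dotProduct, Finset.sum_mul, mul_neg, Finset.sum_neg_distrib,
        mul_assoc]
  have hQ : pd i (fun v => ((ΩXξ v * (Ω v)⁻¹) *ᵥ ΩξH v) a) u =
      (X i u a - ((ΩXξ u * (Ω u)⁻¹) *ᵥ ξ i u) a) * ((ξs i u ᵥ* (Ω u)⁻¹) ⬝ᵥ ΩξH u)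
        + ((ΩXξ u * (Ω u)⁻¹) *ᵥ ξ i u) a * H i u := by
    refine (pd_dotProduct hPd hhd).trans ?_
    simp only [hP, hΩξH i u hu, Matrix.mulVec, dotProduct, Finset.sum_mul, Finset.mul_sum,
      mul_assoc]
  refine (pd_sub (diff (hxsmooth a)) (differentiableAt_dotProduct hPd hhd)).trans ?_
  refine (congrArg₂ _ (hx i u hu a) hQ).trans ?_
  ring
end
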